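/- arXiv:1102.2133 — 2 statements merged into one kernel-verified Lean document; each statement's English description precedes it below -/
import Mathlib

section
/- Let A₁, A₂, B₁, B₂ be four pairwise disjoint closed half-planes in ℍ² bounded by four pairwise disjoint geodesics, and let s₁ be a geodesic segment from a point of ∂A₁ to a point of ∂B₁, and s₂ a geodesic segment from a point of ∂A₂ to a point of ∂B₂. If s₁ ∩ s₂ ≠ ∅, then the arcs Ā₁ ∩ S¹_∞ and B̄₁ ∩ S¹_∞ lie in different connected components of S¹_∞ \ (Ā₂ ∪ B̄₂), where S¹_∞ is the circle at infinity; consequently any path t₁ from ∂A₁ to ∂B₁ and any path t₂ from ∂A₂ to ∂B₂ (each contained in the complement of the four open half-planes together with its boundary appropriately) must intersect, in particular the geodesics joining the same boundary pairs intersect. -/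
/- STATEMENT 2: Four pairwise disjoint closed half-planes A₁, A₂, B₁, B₂ of ℍ², bounded by
pairwise disjoint geodesics.  If a geodesic segment s₁ from ∂A₁ to ∂B₁ meets a geodesic
segment s₂ from ∂A₂ to ∂B₂, then the arcs at infinity of A₁ and B₁ lie in different
components of S¹_∞ ∖ (arc(A₂) ∪ arc(B₂)); consequently any two continuous paths t₁ (from
∂A₁ to ∂B₁) and t₂ (from ∂A₂ to ∂B₂) contained in the complement of the four open
half-planes must intersect — in particular the geodesics joining the same boundary pairs
intersect.

Half-planes are realized as the regions under Euclidean semicircles over disjoint real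
intervals (we normalize so that no arc at infinity contains ∞, and, relabelling the
symmetric pair (A₂,B₂), so that the arc of A₂ lies to the left of the arc of B₂).  The two
components of S¹_∞ ∖ (arc(A₂) ∪ arc(B₂)) are then Ioo a₂' b₂ and (Iio a₂ ∪ Ioi b₂') ∪ {∞}. -/

open Set

local notation "ℍ" => UpperHalfPlane

/-- The closed half-plane of ℍ² lying under the semicircle with endpoints `a < b`. -/
def ClosedHP (a b : ℝ) : Set UpperHalfPlane :=
  {z | (z.re - (a + b) / 2) ^ 2 + z.im ^ 2 ≤ ((b - a) / 2) ^ 2}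

/-- The open half-plane of ℍ² lying strictly under the semicircle with endpoints `a < b`. -/
def OpenHP (a b : ℝ) : Set UpperHalfPlane :=
  {z | (z.re - (a + b) / 2) ^ 2 + z.im ^ 2 < ((b - a) / 2) ^ 2}

/-- The bounding geodesic: the semicircle with endpoints `a < b`. -/
def Geod (a b : ℝ) : Set UpperHalfPlane :=
  {z | (z.re - (a + b) / 2) ^ 2 + z.im ^ 2 = ((b - a) / 2) ^ 2}

/-- A unit-speed geodesic segment parametrized on `Icc 0 T`. -/
def IsGeodSegOn (s : ℝ → UpperHalfPlane) (T : ℝ) : Prop :=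
  ∀ u ∈ Set.Icc (0 : ℝ) T, ∀ v ∈ Set.Icc (0 : ℝ) T, dist (s u) (s v) = |u - v|

/-- If `z` lies on the hyperbolic segment from `x` to `y`, then in the hyperboloid model the
vector of `z` is the expected combination of those of `x` and `y`; the hypotheses express the
three vectors and the distances `a`, `b` by means of the Minkowski form `q ^ 2 - p * r`. -/
lemma hyperboloid_combination {px qx rx py qy ry pz qz rz sa ca sb cb : ℝ}
    (hx : px * rx - qx ^ 2 = 1) (hy : py * ry - qy ^ 2 = 1) (hz : pz * rz - qz ^ 2 = 1)
    (hca : ca = (px * rz + pz * rx - 2 * qx * qz) / 2)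
    (hcb : cb = (pz * ry + py * rz - 2 * qz * qy) / 2)
    (hcab : ca * cb + sa * sb = (px * ry + py * rx - 2 * qx * qy) / 2)
    (ha : ca ^ 2 = 1 + sa ^ 2) (hb : cb ^ 2 = 1 + sb ^ 2) :
    (sa * cb + ca * sb) * pz = sb * px + sa * py ∧
    (sa * cb + ca * sb) * qz = sb * qx + sa * qy ∧
    (sa * cb + ca * sb) * rz = sb * rx + sa * ry := by
  set S := sa * cb + ca * sb with hS
  obtain ⟨wp, hwp⟩ : ∃ w, w = S * pz - sb * px - sa * py := ⟨_, rfl⟩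
  obtain ⟨wq, hwq⟩ : ∃ w, w = S * qz - sb * qx - sa * qy := ⟨_, rfl⟩
  obtain ⟨wr, hwr⟩ : ∃ w, w = S * rz - sb * rx - sa * ry := ⟨_, rfl⟩
  have horth : wp * rz + pz * wr - 2 * wq * qz = 0 := by
    rw [hwp, hwq, hwr]
    linear_combination 2 * S * hz + 2 * sb * hca + 2 * sa * hcb + 2 * hS
  have hnull : wp * wr - wq ^ 2 = 0 := by
    have h1 : wp * wr - wq ^ 2 = S ^ 2 + sb ^ 2 + sa ^ 2 - 2 * S * sb * ca - 2 * S * sa * cb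
        + 2 * sa * sb * (ca * cb + sa * sb) := by
      rw [hwp, hwq, hwr, hcab]
      linear_combination S ^ 2 * hz + sb ^ 2 * hx + sa ^ 2 * hy + 2 * S * sb * hca
        + 2 * S * sa * hcb
    rw [h1, hS]
    linear_combination (-sb ^ 2) * ha - sa ^ 2 * hb
  have hsum : (wq * rz - wr * qz) ^ 2 + wr ^ 2 = 0 := by
    linear_combination wr * rz * horth - rz ^ 2 * hnull - wr ^ 2 * hz
  have hr : wr = 0 := by
    have h := sq_nonneg (wq * rz - wr * qz)
    have h' := sq_nonneg wr
    exact pow_eq_zero_iff two_ne_zero |>.mp (by linarith)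
  have hq : wq = 0 := by
    have : wq ^ 2 = 0 := by rw [hr] at hnull; linarith
    exact pow_eq_zero_iff two_ne_zero |>.mp this
  have hrz : rz ≠ 0 := by
    rintro rfl
    nlinarith [sq_nonneg qz]
  have hp : wp = 0 := by
    rw [hr, hq] at horth
    simpa [hrz] using horth
  exact ⟨by linarith, by linarith, by linarith⟩

/-- The signed function of a point whose zero set is the geodesic with endpoints `p` and `q`. -/
noncomputable def side (p q : ℝ) (z : UpperHalfPlane) : ℝ :=
  ((z.re - p) * (z.re - q) + z.im ^ 2) / z.im

lemma sinh_dist_mul_side (p q : ℝ) {x y z : UpperHalfPlane}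
    (h : dist x y = dist x z + dist z y) :
    Real.sinh (dist x y) * side p q z =
      Real.sinh (dist z y) * side p q x + Real.sinh (dist x z) * side p q y := by
  have hx := x.im_ne_zero
  have hy := y.im_ne_zero
  have hz := z.im_ne_zero
  obtain ⟨h1, h2, h3⟩ := hyperboloid_combination
    (px := (x.re ^ 2 + x.im ^ 2) / x.im) (qx := x.re / x.im) (rx := 1 / x.im)
    (py := (y.re ^ 2 + y.im ^ 2) / y.im) (qy := y.re / y.im) (ry := 1 / y.im)
    (pz := (z.re ^ 2 + z.im ^ 2) / z.im) (qz := z.re / z.im) (rz := 1 / z.im)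
    (sa := Real.sinh (dist x z)) (ca := Real.cosh (dist x z))
    (sb := Real.sinh (dist z y)) (cb := Real.cosh (dist z y))
    (by field_simp; ring) (by field_simp; ring) (by field_simp; ring)
    (by rw [UpperHalfPlane.cosh_dist']; field_simp; ring)
    (by rw [UpperHalfPlane.cosh_dist']; field_simp; ring)
    (by rw [← Real.cosh_add, ← h, UpperHalfPlane.cosh_dist']; field_simp; ring)
    (by rw [Real.cosh_sq]; ring) (by rw [Real.cosh_sq]; ring)
  rw [← Real.sinh_add, ← h] at h1 h2 h3
  have hside : ∀ w : UpperHalfPlane, side p q w =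
      (w.re ^ 2 + w.im ^ 2) / w.im - (p + q) * (w.re / w.im) + p * q * (1 / w.im) := by
    intro w
    have := w.im_ne_zero
    rw [side]
    field_simp
    ring
  simp only [hside]
  linear_combination h1 - (p + q) * h2 + p * q * h3

lemma IsGeodSegOn.sinh_mul_side {s : ℝ → UpperHalfPlane} {T u : ℝ} (hs : IsGeodSegOn s T)
    (hu : u ∈ Icc 0 T) (p q : ℝ) :
    Real.sinh T * side p q (s u) =
      Real.sinh (T - u) * side p q (s 0) + Real.sinh u * side p q (s T) := by
  have hT : 0 ≤ T := hu.1.trans hu.2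
  have h0 : (0 : ℝ) ∈ Icc 0 T := ⟨le_rfl, hT⟩
  have h1 : T ∈ Icc 0 T := ⟨hT, le_rfl⟩
  have e1 : dist (s 0) (s T) = T := by
    rw [hs _ h0 _ h1, zero_sub, abs_neg, abs_of_nonneg hT]
  have e2 : dist (s 0) (s u) = u := by
    rw [hs _ h0 _ hu, zero_sub, abs_neg, abs_of_nonneg hu.1]
  have e3 : dist (s u) (s T) = T - u := by
    rw [hs _ hu _ h1, abs_sub_comm, abs_of_nonneg (sub_nonneg.2 hu.2)]
  have := sinh_dist_mul_side p q (x := s 0) (y := s T) (z := s u) (by rw [e1, e2, e3]; ring)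
  rwa [e1, e2, e3] at this

lemma IsGeodSegOn.side_nonpos {s : ℝ → UpperHalfPlane} {T u p q : ℝ}
    (hs : IsGeodSegOn s T) (hT : 0 < T) (hu : u ∈ Icc 0 T)
    (h0 : side p q (s 0) ≤ 0) (h1 : side p q (s T) ≤ 0) : side p q (s u) ≤ 0 := by
  have h := hs.sinh_mul_side hu p q
  have hT' := Real.sinh_pos_iff.2 hT
  have ha := Real.sinh_nonneg_iff.2 hu.1
  have hb := Real.sinh_nonneg_iff.2 (sub_nonneg.2 hu.2)
  by_contra! hc
  nlinarith [mul_pos hT' hc, mul_nonneg hb (neg_nonneg.2 h0), mul_nonneg ha (neg_nonneg.2 h1)]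

lemma IsGeodSegOn.side_pos {s : ℝ → UpperHalfPlane} {T u p q : ℝ}
    (hs : IsGeodSegOn s T) (hT : 0 < T) (hu : u ∈ Icc 0 T)
    (h0 : 0 < side p q (s 0)) (h1 : 0 < side p q (s T)) : 0 < side p q (s u) := by
  have h := hs.sinh_mul_side hu p q
  have hT' := Real.sinh_pos_iff.2 hT
  rcases hu.1.eq_or_lt with rfl | hu0
  · exact h0
  have ha := Real.sinh_pos_iff.2 hu0
  have hb := Real.sinh_nonneg_iff.2 (sub_nonneg.2 hu.2)
  refine pos_of_mul_pos_right (a := Real.sinh T) ?_ hT'.le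
  rw [h]
  exact add_pos_of_nonneg_of_pos (mul_nonneg hb h0.le) (mul_pos ha h1)

lemma mem_Geod_iff {a b : ℝ} {z : UpperHalfPlane} :
    z ∈ Geod a b ↔ (z.re - a) * (z.re - b) + z.im ^ 2 = 0 := by
  rw [Geod, mem_ofPred_eq]
  constructor <;> intro h <;> linear_combination h

lemma re_mem_Ioo_of_mem_Geod {a b : ℝ} (hab : a < b) {z : UpperHalfPlane}
    (h : z ∈ Geod a b) : z.re ∈ Ioo a b := by
  have him := pow_pos z.im_pos 2
  rw [mem_Geod_iff] at h
  constructor <;> by_contra! hc <;> nlinarith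

lemma side_nonpos_of_mem_Geod {a b p q : ℝ} (hab : a < b) (hp : p ≤ a) (hq : b ≤ q)
    {z : UpperHalfPlane} (h : z ∈ Geod a b) : side p q z ≤ 0 := by
  obtain ⟨h1, h2⟩ := re_mem_Ioo_of_mem_Geod hab h
  rw [mem_Geod_iff] at h
  refine div_nonpos_of_nonpos_of_nonneg ?_ z.im_pos.le
  nlinarith [mul_le_mul (sub_le_sub_left hp z.re) (sub_le_sub_right hq z.re)
    (by linarith) (by linarith)]

lemma side_pos_of_mem_Geod {a b p q : ℝ} (hab : a < b) (hpq : p ≤ q)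
    (hd : b ≤ p ∨ q ≤ a) {z : UpperHalfPlane} (h : z ∈ Geod a b) : 0 < side p q z := by
  obtain ⟨h1, h2⟩ := re_mem_Ioo_of_mem_Geod hab h
  refine div_pos (add_pos_of_pos_of_nonneg ?_ (sq_nonneg _)) z.im_pos
  rcases hd with hd | hd
  · exact mul_pos_of_neg_of_neg (by linarith) (by linarith)
  · exact mul_pos (by linarith) (by linarith)

/-- Two geodesic segments do not meet if a geodesic separates their endpoints. -/
lemma IsGeodSegOn.ne_of_separated {s t : ℝ → UpperHalfPlane} {S T u v p q : ℝ}
    {a b c d a' b' c' d' : ℝ} (hab : a < b) (hcd : c < d) (hab' : a' < b') (hcd' : c' < d')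
    (hs : IsGeodSegOn s S) (ht : IsGeodSegOn t T) (hS : 0 < S) (hT : 0 < T)
    (hu : u ∈ Icc 0 S) (hv : v ∈ Icc 0 T)
    (hs0 : s 0 ∈ Geod a b) (hs1 : s S ∈ Geod c d)
    (ht0 : t 0 ∈ Geod a' b') (ht1 : t T ∈ Geod c' d')
    (hpa : p ≤ a) (hbq : b ≤ q) (hpc : p ≤ c) (hdq : d ≤ q)
    (hd0 : b' ≤ p ∨ q ≤ a') (hd1 : d' ≤ p ∨ q ≤ c') : s u ≠ t v := by
  intro h
  have hpq : p ≤ q := by linarith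
  have h1 := hs.side_nonpos hS hu (side_nonpos_of_mem_Geod hab hpa hbq hs0)
    (side_nonpos_of_mem_Geod hcd hpc hdq hs1)
  have h2 := ht.side_pos hT hv (side_pos_of_mem_Geod hab' hpq hd0 ht0)
    (side_pos_of_mem_Geod hcd' hpq hd1 ht1)
  rw [h] at h1
  exact h1.not_gt h2

/-- The increment of a continuous logarithm along a path staying in a rotated slit plane. -/
lemma sub_eq_log_sub_log {g L : ℝ → ℂ} {w : ℂ} (hg : Continuous g) (hL : Continuous L)
    (hexp : ∀ v, Complex.exp (L v) = g v) (hslit : ∀ v, w * g v ∈ Complex.slitPlane) (x y : ℝ) :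
    L y - L x = Complex.log (w * g y) - Complex.log (w * g x) := by
  have h : L = fun v ↦ Complex.log (w * g v) + (L x - Complex.log (w * g x)) := by
    refine Complex.isCoveringMap_exp.eq_of_comp_eq hL
      (((continuous_const.mul hg).clog hslit).add continuous_const) ?_ x (by ring)
    funext v
    refine Subtype.ext ?_
    have h0 := Complex.slitPlane_ne_zero (hslit x)
    simp only [Function.comp_apply]
    rw [Complex.exp_add, Complex.exp_sub, Complex.exp_log (Complex.slitPlane_ne_zero (hslit v)),
      Complex.exp_log h0, hexp, hexp]
    have h1 := right_ne_zero_of_mul h0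
    have h2 := left_ne_zero_of_mul h0
    field_simp
  have := congrFun h y
  linear_combination this

lemma neg_I_mul_mem_slitPlane {z : ℂ} (hz : z ≠ 0) (him : 0 ≤ z.im) :
    -Complex.I * z ∈ Complex.slitPlane := by
  rw [Complex.mem_slitPlane_iff]
  simp only [Complex.mul_re, Complex.mul_im, Complex.neg_re, Complex.neg_im, Complex.I_re,
    Complex.I_im]
  rcases him.lt_or_eq with h | h
  · left; linarith
  · right
    intro h'
    exact hz (Complex.ext (by simp; linarith) (by simp; linarith))

lemma I_mul_mem_slitPlane {z : ℂ} (hz : z ≠ 0) (him : z.im ≤ 0) :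
    Complex.I * z ∈ Complex.slitPlane := by
  simpa using neg_I_mul_mem_slitPlane (neg_ne_zero.2 hz) (by simpa using him)

lemma log_I_mul_im {x : ℝ} (hx : x ≠ 0) :
    (Complex.log (Complex.I * x)).im = if 0 < x then Real.pi / 2 else -(Real.pi / 2) := by
  rw [Complex.log_im]
  split_ifs with h
  · rw [mul_comm, Complex.arg_real_mul _ h, Complex.arg_I]
  · have hneg : 0 < -x := neg_pos.2 (lt_of_le_of_ne (not_lt.1 h) hx)
    have : Complex.I * (x : ℂ) = ((-x : ℝ) : ℂ) * -Complex.I := by push_cast; ring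
    rw [this, Complex.arg_real_mul _ hneg, Complex.arg_neg_I]

lemma log_neg_I_mul_im {x : ℝ} (hx : x ≠ 0) :
    (Complex.log (-Complex.I * x)).im = if 0 < x then -(Real.pi / 2) else Real.pi / 2 := by
  have : -Complex.I * (x : ℂ) = Complex.I * ((-x : ℝ) : ℂ) := by push_cast; ring
  rw [this, log_I_mul_im (neg_ne_zero.2 hx)]
  rcases hx.lt_or_gt with h | h
  · rw [if_pos (neg_pos.2 h), if_neg h.not_gt]
  · rw [if_neg (by linarith), if_pos h]

/-- Two sets in the closed upper half-plane that join linked pairs of real points meet. -/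
lemma JoinedIn.inter_nonempty_of_linked {F G : Set ℂ} {m n p q : ℝ}
    (hF : JoinedIn F (m : ℂ) n) (hG : JoinedIn G (p : ℂ) q)
    (hFim : ∀ z ∈ F, 0 ≤ z.im) (hGim : ∀ z ∈ G, 0 ≤ z.im)
    (hpm : p < m) (hmq : m < q) (hn : n < p ∨ q < n) : (F ∩ G).Nonempty := by
  by_contra! hFG
  obtain ⟨γ, hγ⟩ := hF
  obtain ⟨δ, hδ⟩ := hG
  have hγF : ∀ u, γ.extend u ∈ F := fun u ↦ hγ _
  have hδG : ∀ v, δ.extend v ∈ G := fun v ↦ hδ _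
  have hγim := fun u ↦ hFim _ (hγF u)
  have hδim := fun v ↦ hGim _ (hδG v)
  have hne : ∀ u v, γ.extend u - δ.extend v ≠ 0 := by
    intro u v h
    have : γ.extend u ∈ F ∩ G := ⟨hγF u, sub_eq_zero.1 h ▸ hδG v⟩
    simp [hFG] at this
  have hγc := γ.continuous_extend
  have hδc := δ.continuous_extend
  obtain ⟨L, hLc, hL⟩ := Complex.exists_continuousOn_eqOn_exp_comp (X := ℝ × ℝ) (U := univ)
    ((Homeomorph.Set.univ (ℝ × ℝ)).toHomotopyEquiv.simplyConnectedSpace_iff.2 inferInstance)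
    isOpen_univ
    (g := fun x ↦ γ.extend x.1 - δ.extend x.2) (by fun_prop)
    (by rintro ⟨x, -, hx⟩; exact hne _ _ hx)
  rw [continuousOn_univ] at hLc
  replace hL : ∀ u v, Complex.exp (L (u, v)) = γ.extend u - δ.extend v :=
    fun u v ↦ hL (mem_univ (u, v))
  have e1 := sub_eq_log_sub_log (g := fun v ↦ γ.extend 0 - δ.extend v) (L := fun v ↦ L (0, v))
    (w := Complex.I) (by fun_prop) (by fun_prop) (fun v ↦ hL 0 v)
    (fun v ↦ I_mul_mem_slitPlane (hne _ _) (by simpa using hδim v)) 0 1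
  have e2 := sub_eq_log_sub_log (g := fun v ↦ γ.extend 1 - δ.extend v) (L := fun v ↦ L (1, v))
    (w := Complex.I) (by fun_prop) (by fun_prop) (fun v ↦ hL 1 v)
    (fun v ↦ I_mul_mem_slitPlane (hne _ _) (by simpa using hδim v)) 0 1
  have e3 := sub_eq_log_sub_log (g := fun u ↦ γ.extend u - δ.extend 0) (L := fun u ↦ L (u, 0))
    (w := -Complex.I) (by fun_prop) (by fun_prop) (fun u ↦ hL u 0)
    (fun u ↦ neg_I_mul_mem_slitPlane (hne _ _) (by simpa using hγim u)) 0 1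
  have e4 := sub_eq_log_sub_log (g := fun u ↦ γ.extend u - δ.extend 1) (L := fun u ↦ L (u, 1))
    (w := -Complex.I) (by fun_prop) (by fun_prop) (fun u ↦ hL u 1)
    (fun u ↦ neg_I_mul_mem_slitPlane (hne _ _) (by simpa using hγim u)) 0 1
  simp only [Path.extend_zero, Path.extend_one, ← Complex.ofReal_sub] at e1 e2 e3 e4
  replace e1 := congrArg Complex.im e1
  replace e2 := congrArg Complex.im e2
  replace e3 := congrArg Complex.im e3
  replace e4 := congrArg Complex.im e4
  have hmp : m - p ≠ 0 := by linarith
  have hmq' : m - q ≠ 0 := by linarith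
  have hnp : n - p ≠ 0 := by rcases hn with hn | hn <;> intro h <;> linarith
  have hnq : n - q ≠ 0 := by rcases hn with hn | hn <;> intro h <;> linarith
  simp only [Complex.sub_im, log_I_mul_im, log_neg_I_mul_im, hmp, hmq', hnp, hnq, ne_eq,
    not_false_eq_true] at e1 e2 e3 e4
  have hpi := Real.pi_pos
  rw [if_neg (by linarith), if_pos (by linarith)] at e1
  rcases hn with hn | hn
  · rw [if_neg (by linarith), if_neg (by linarith)] at e2
    rw [if_neg (by linarith), if_pos (by linarith)] at e3
    rw [if_neg (by linarith), if_neg (by linarith)] at e4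
    linarith
  · rw [if_pos (by linarith), if_pos (by linarith)] at e2
    rw [if_pos (by linarith), if_pos (by linarith)] at e3
    rw [if_pos (by linarith), if_neg (by linarith)] at e4
    linarith

/-- The open Euclidean half-disc with diameter `[a, b]`, together with its open diameter. -/
def halfDisc (a b : ℝ) : Set ℂ :=
  {z | (z.re - (a + b) / 2) ^ 2 + z.im ^ 2 < ((b - a) / 2) ^ 2 ∧ 0 ≤ z.im}

lemma re_mem_Icc_of_mem_halfDisc {a b : ℝ} (hab : a < b) {z : ℂ} (hz : z ∈ halfDisc a b) :
    z.re ∈ Icc a b := by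
  have h := abs_lt_of_sq_lt_sq (lt_of_le_of_lt (le_add_of_nonneg_right (sq_nonneg z.im)) hz.1)
    (by linarith)
  rw [abs_lt] at h
  constructor <;> linarith [h.1, h.2]

lemma joinedIn_center {a b : ℝ} (hab : a < b) {z : UpperHalfPlane} (hz : z ∈ Geod a b) :
    JoinedIn (insert (z : ℂ) (halfDisc a b)) (((a + b) / 2 : ℝ) : ℂ) z := by
  refine JoinedIn.ofLine
    (f := fun t : ℝ ↦ (((a + b) / 2 : ℝ) : ℂ) + t * ((z : ℂ) - (((a + b) / 2 : ℝ) : ℂ)))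
    (by fun_prop) (by simp) (by simp) ?_
  rintro _ ⟨t, ⟨ht0, ht1⟩, rfl⟩
  rcases ht1.eq_or_lt with rfl | ht1
  · left; simp
  right
  have hz' : (z.re - (a + b) / 2) ^ 2 + z.im ^ 2 = ((b - a) / 2) ^ 2 := hz
  constructor
  · have hr : 0 < ((b - a) / 2) ^ 2 := by have := sub_pos.2 hab; positivity
    have ht : t ^ 2 < 1 := by nlinarith
    have : t ^ 2 * ((b - a) / 2) ^ 2 < ((b - a) / 2) ^ 2 := by nlinarith
    refine lt_of_eq_of_lt ?_ this
    rw [← hz']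
    simp only [Complex.add_re, Complex.add_im, Complex.re_ofReal_mul, Complex.im_ofReal_mul,
      Complex.sub_re, Complex.sub_im, Complex.ofReal_re, Complex.ofReal_im,
      UpperHalfPlane.coe_re, UpperHalfPlane.coe_im]
    ring
  · simp only [Complex.add_im, Complex.im_ofReal_mul, Complex.sub_im, Complex.ofReal_im,
      UpperHalfPlane.coe_im]
    have := mul_nonneg ht0 z.im_pos.le
    linarith

/-- A path between two geodesics, prolonged to the centres of their half-discs. -/
lemma joinedIn_centers {a b c d : ℝ} (hab : a < b) (hcd : c < d) {t : ℝ → UpperHalfPlane}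
    (ht : ContinuousOn t (Icc 0 1)) (ht0 : t 0 ∈ Geod a b) (ht1 : t 1 ∈ Geod c d) :
    JoinedIn ((fun u ↦ (t u : ℂ)) '' Icc 0 1 ∪ (halfDisc a b ∪ halfDisc c d))
      (((a + b) / 2 : ℝ) : ℂ) (((c + d) / 2 : ℝ) : ℂ) := by
  have h0 := (joinedIn_center hab ht0).mono
    (V := (fun u ↦ (t u : ℂ)) '' Icc 0 1 ∪ (halfDisc a b ∪ halfDisc c d)) <| by
      refine insert_subset (.inl ⟨0, by simp, rfl⟩) fun z hz ↦ .inr (.inl hz)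
  have h1 := (joinedIn_center hcd ht1).mono
    (V := (fun u ↦ (t u : ℂ)) '' Icc 0 1 ∪ (halfDisc a b ∪ halfDisc c d)) <| by
      refine insert_subset (.inl ⟨1, by simp, rfl⟩) fun z hz ↦ .inr (.inr hz)
  refine (h0.trans ?_).trans h1.symm
  exact JoinedIn.ofLine (f := fun u ↦ (t u : ℂ))
    (UpperHalfPlane.continuous_coe.comp_continuousOn ht) rfl rfl subset_union_left

lemma lt_or_lt_of_disjoint_Icc {a b c d : ℝ} (hab : a ≤ b) (hcd : c ≤ d)
    (h : Disjoint (Icc a b) (Icc c d)) : b < c ∨ d < a := by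
  by_contra! hc
  refine disjoint_left.1 h (show max a c ∈ Icc a b from ⟨le_max_left _ _, ?_⟩)
    ⟨le_max_right _ _, ?_⟩
  · exact max_le hab hc.1
  · exact max_le hc.2 hcd

theorem crossing_segments_separate_arcs_at_infinity
    -- arcs at infinity of A₁, B₁, A₂, B₂ :
    (a₁ b₁ c₁ d₁ a₂ b₂ a₂' b₂' : ℝ)
    (h₁ : a₁ < b₁) (h₂ : c₁ < d₁) (h₃ : a₂ < b₂) (h₄ : a₂' < b₂')
    (horder : b₂ < a₂')   -- arc of A₂ to the left of arc of B₂ (relabelling if necessary)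
    -- the four closed arcs at infinity are pairwise disjoint :
    (hdisj : Pairwise (Function.onFun Disjoint
      ![Set.Icc a₁ b₁, Set.Icc c₁ d₁, Set.Icc a₂ b₂, Set.Icc a₂' b₂']))
    -- s₁ : geodesic segment from ∂A₁ to ∂B₁, s₂ : from ∂A₂ to ∂B₂ :
    (s₁ s₂ : ℝ → ℍ) (T₁ T₂ : ℝ) (hT₁ : 0 < T₁) (hT₂ : 0 < T₂)
    (hs₁ : IsGeodSegOn s₁ T₁) (hs₂ : IsGeodSegOn s₂ T₂)
    (hs₁0 : s₁ 0 ∈ Geod a₁ b₁) (hs₁T : s₁ T₁ ∈ Geod c₁ d₁)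
    (hs₂0 : s₂ 0 ∈ Geod a₂ b₂) (hs₂T : s₂ T₂ ∈ Geod a₂' b₂')
    -- s₁ and s₂ intersect :
    (hmeet : ∃ u ∈ Set.Icc (0:ℝ) T₁, ∃ v ∈ Set.Icc (0:ℝ) T₂, s₁ u = s₂ v) :
    -- conclusion 1: the arcs of A₁ and B₁ lie in different components of
    -- S¹_∞ ∖ (arc(A₂) ∪ arc(B₂)) :
    ((Set.Icc a₁ b₁ ⊆ Set.Ioo b₂ a₂' ∧ Set.Icc c₁ d₁ ⊆ Set.Iio a₂ ∪ Set.Ioi b₂') ∨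
     (Set.Icc c₁ d₁ ⊆ Set.Ioo b₂ a₂' ∧ Set.Icc a₁ b₁ ⊆ Set.Iio a₂ ∪ Set.Ioi b₂'))
    ∧
    -- conclusion 2: any continuous path from ∂A₁ to ∂B₁ avoiding the four open half-planes
    -- meets any continuous path from ∂A₂ to ∂B₂ avoiding the four open half-planes :
    (∀ t₁ t₂ : ℝ → ℍ,
      ContinuousOn t₁ (Set.Icc 0 1) → ContinuousOn t₂ (Set.Icc 0 1) →
      t₁ 0 ∈ Geod a₁ b₁ → t₁ 1 ∈ Geod c₁ d₁ →
      t₂ 0 ∈ Geod a₂ b₂ → t₂ 1 ∈ Geod a₂' b₂' →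
      (∀ u ∈ Set.Icc (0:ℝ) 1, t₁ u ∉
        OpenHP a₁ b₁ ∪ OpenHP c₁ d₁ ∪ OpenHP a₂ b₂ ∪ OpenHP a₂' b₂') →
      (∀ u ∈ Set.Icc (0:ℝ) 1, t₂ u ∉
        OpenHP a₁ b₁ ∪ OpenHP c₁ d₁ ∪ OpenHP a₂ b₂ ∪ OpenHP a₂' b₂') →
      ∃ u ∈ Set.Icc (0:ℝ) 1, ∃ v ∈ Set.Icc (0:ℝ) 1, t₁ u = t₂ v) := by
  have dA2 : Disjoint (Icc a₁ b₁) (Icc a₂ b₂) := hdisj (i := 0) (j := 2) (by decide)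
  have dA2' : Disjoint (Icc a₁ b₁) (Icc a₂' b₂') := hdisj (i := 0) (j := 3) (by decide)
  have dB2 : Disjoint (Icc c₁ d₁) (Icc a₂ b₂) := hdisj (i := 1) (j := 2) (by decide)
  have dB2' : Disjoint (Icc c₁ d₁) (Icc a₂' b₂') := hdisj (i := 1) (j := 3) (by decide)
  obtain ⟨u, hu, v, hv, huv⟩ := hmeet
  have inside_or_outside : ∀ {a b : ℝ}, a < b → Disjoint (Icc a b) (Icc a₂ b₂) →
      Disjoint (Icc a b) (Icc a₂' b₂') → (b₂ < a ∧ b < a₂') ∨ (b < a₂ ∨ b₂' < a) := by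
    intro a b hab h h'
    rcases lt_or_lt_of_disjoint_Icc hab.le h₃.le h with h | h
    · exact .inr (.inl h)
    rcases lt_or_lt_of_disjoint_Icc hab.le h₄.le h' with h' | h'
    · exact .inl ⟨h, h'⟩
    · exact .inr (.inr h')
  have linked : (b₂ < a₁ ∧ b₁ < a₂') ∧ (d₁ < a₂ ∨ b₂' < c₁) ∨
      (b₂ < c₁ ∧ d₁ < a₂') ∧ (b₁ < a₂ ∨ b₂' < a₁) := by
    rcases inside_or_outside h₁ dA2 dA2' with hA | hA <;>
      rcases inside_or_outside h₂ dB2 dB2' with hB | hB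
    · refine absurd huv (hs₁.ne_of_separated (p := min a₁ c₁) (q := max b₁ d₁) h₁ h₂ h₃ h₄ hs₂
        hT₁ hT₂ hu hv hs₁0 hs₁T hs₂0 hs₂T (min_le_left _ _) (le_max_left _ _) (min_le_right _ _)
        (le_max_right _ _) (.inl ?_) (.inr ?_))
      · exact le_min hA.1.le hB.1.le
      · exact max_le hA.2.le hB.2.le
    · exact .inl ⟨hA, hB⟩
    · exact .inr ⟨hB, hA⟩
    · exact absurd huv.symm (hs₂.ne_of_separated (p := a₂) (q := b₂') h₃ h₄ h₁ h₂ hs₁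
        hT₂ hT₁ hv hu hs₂0 hs₂T hs₁0 hs₁T le_rfl (by linarith) (by linarith) le_rfl
        (hA.imp le_of_lt le_of_lt) (hB.imp le_of_lt le_of_lt))
  have inside : ∀ {a b : ℝ}, b₂ < a ∧ b < a₂' → Icc a b ⊆ Ioo b₂ a₂' :=
    fun h x hx ↦ ⟨h.1.trans_le hx.1, hx.2.trans_lt h.2⟩
  have outside : ∀ {a b : ℝ}, b < a₂ ∨ b₂' < a → Icc a b ⊆ Iio a₂ ∪ Ioi b₂' :=
    fun h x hx ↦ h.imp (fun h ↦ hx.2.trans_lt h) (fun h ↦ h.trans_le hx.1)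
  refine ⟨linked.imp (fun h ↦ ⟨inside h.1, outside h.2⟩) (fun h ↦ ⟨inside h.1, outside h.2⟩), ?_⟩
  intro t₁ t₂ ht₁ ht₂ ht₁0 ht₁1 ht₂0 ht₂1 ho₁ ho₂
  have J₁ := joinedIn_centers h₁ h₂ ht₁ ht₁0 ht₁1
  have J₂ := joinedIn_centers h₃ h₄ ht₂ ht₂0 ht₂1
  have im_nonneg : ∀ {t : ℝ → ℍ} {a b c d : ℝ},
      ∀ z ∈ (fun u ↦ (t u : ℂ)) '' Icc 0 1 ∪ (halfDisc a b ∪ halfDisc c d), 0 ≤ z.im := by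
    rintro t a b c d z (⟨u, -, rfl⟩ | hz | hz)
    exacts [(t u).im_pos.le, hz.2, hz.2]
  have hmeet : (((fun u ↦ (t₁ u : ℂ)) '' Icc 0 1 ∪ (halfDisc a₁ b₁ ∪ halfDisc c₁ d₁)) ∩
      ((fun u ↦ (t₂ u : ℂ)) '' Icc 0 1 ∪ (halfDisc a₂ b₂ ∪ halfDisc a₂' b₂'))).Nonempty := by
    rcases linked with ⟨h, h'⟩ | ⟨h, h'⟩
    · exact J₁.inter_nonempty_of_linked J₂ im_nonneg im_nonneg (by linarith) (by linarith)
        (h'.imp (fun _ ↦ by linarith) (fun _ ↦ by linarith))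
    · exact J₁.symm.inter_nonempty_of_linked J₂ im_nonneg im_nonneg (by linarith) (by linarith)
        (h'.imp (fun _ ↦ by linarith) (fun _ ↦ by linarith))
  have discs_disjoint : ∀ {a b c d : ℝ} {z : ℂ}, a < b → c < d →
      Disjoint (Icc a b) (Icc c d) → z ∈ halfDisc a b → z ∈ halfDisc c d → False :=
    fun hab hcd h hz hz' ↦ disjoint_left.1 h (re_mem_Icc_of_mem_halfDisc hab hz)
      (re_mem_Icc_of_mem_halfDisc hcd hz')
  have mem_open : ∀ {a b : ℝ} {w : ℍ}, (w : ℂ) ∈ halfDisc a b → w ∈ OpenHP a b :=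
    fun h ↦ h.1
  obtain ⟨z, ⟨u, hu, rfl⟩ | hz, hz'⟩ := hmeet
  · rcases hz' with ⟨v, hv, hvu⟩ | h | h
    · exact ⟨u, hu, v, hv, UpperHalfPlane.ext hvu.symm⟩
    · exact absurd (.inl (.inr (mem_open h))) (ho₁ u hu)
    · exact absurd (.inr (mem_open h)) (ho₁ u hu)
  · rcases hz' with ⟨v, hv, rfl⟩ | h'
    · rcases hz with h | h
      · exact absurd (.inl (.inl (.inl (mem_open h)))) (ho₂ v hv)
      · exact absurd (.inl (.inl (.inr (mem_open h)))) (ho₂ v hv)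
    · rcases hz with h | h <;> rcases h' with h' | h'
      exacts [(discs_disjoint h₁ h₃ dA2 h h').elim, (discs_disjoint h₁ h₄ dA2' h h').elim,
        (discs_disjoint h₂ h₃ dB2 h h').elim, (discs_disjoint h₂ h₄ dB2' h h').elim]
end

section
/- With the setup of a pair of pants P and lifts L̃₁, L̃₂, L̃₃ bounding a region meeting S¹_∞ in disjoint arcs I₁, I₂, I₃ (Iᵢ opposite L̃ᵢ), and deck transformations γᵢ preserving L̃ᵢ: for every integer m > 0, both endpoints at infinity of the geodesic γ_{i+1}^m(L̃ᵢ) lie in the arc Iᵢ (indices mod 3). -/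
/- STATEMENT 15: For the pants configuration of three disjoint lifts L̃₁, L̃₂, L̃₃ bounding a
common region of ℍ² meeting S¹_∞ in disjoint arcs I₁, I₂, I₃ (Iᵢ opposite L̃ᵢ), and the
deck transformations γᵢ = R_{i+2}∘R_{i+1}: for every m > 0, both endpoints at infinity of
the geodesic γ_{i+1}^m(L̃ᵢ) lie in the arc Iᵢ.  The endpoints at infinity of a geodesic g
of ℍ² are the real points in the closure of g in ℂ.

We normalize the configuration so that L̃₁ is the semicircle over [A,B] and L̃₂, L̃₃ are the
semicircles over [a₂,b₂], [a₃,b₃] with A < a₂ < b₂ < a₃ < b₃ < B; then I₁ = [b₂,a₃],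
I₂ = [b₃,B], I₃ = [A,a₂].  A reflection Rⱼ is axiomatized as a nontrivial isometric
involution of ℍ² preserving each of the two geodesics other than L̃ⱼ; the action of an
isometry on a boundary point x ∈ S¹_∞ = ℝ is expressed by the limit of its values along
the filter of neighbourhoods of x. -/

open Set Filter

local notation "ℍ" => UpperHalfPlane

/-- The geodesic of the upper half-plane which is the semicircle with endpoints `a < b`. -/
def Semicircle (a b : ℝ) : Set UpperHalfPlane :=
  {z | (z.re - (a + b) / 2) ^ 2 + z.im ^ 2 = ((b - a) / 2) ^ 2}

/-- The boundary extension of a self-map `φ` of ℍ² sends the boundary point `x ∈ ℝ` to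
`y ∈ ℝ`. -/
def BdryTo (φ : UpperHalfPlane → UpperHalfPlane) (x y : ℝ) : Prop :=
  Tendsto (fun z : UpperHalfPlane => (φ z : ℂ))
    (Filter.comap (fun z : UpperHalfPlane => (z : ℂ)) (nhds (x : ℂ))) (nhds (y : ℂ))

namespace PairOfPants

open UpperHalfPlane (cosh_dist' ext_re_im)

theorem mem_semicircle_iff {a b : ℝ} {z : ℍ} :
    z ∈ Semicircle a b ↔ (z.re - a) * (z.re - b) + z.im ^ 2 = 0 := by
  simp only [Semicircle, mem_ofPred_eq]
  constructor <;> intro h <;> linarith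

theorem semicircle_comm (a b : ℝ) : Semicircle a b = Semicircle b a := by
  ext z
  rw [mem_semicircle_iff, mem_semicircle_iff, mul_comm]

theorem cosh_dist_eq_of_isometry {f : ℍ → ℍ} (hf : Isometry f) (z w : ℍ) :
    (((f z).re - (f w).re) ^ 2 + (f z).im ^ 2 + (f w).im ^ 2) / (2 * (f z).im * (f w).im) =
      ((z.re - w.re) ^ 2 + z.im ^ 2 + w.im ^ 2) / (2 * z.im * w.im) := by
  rw [← cosh_dist', ← cosh_dist', hf.dist_eq]

/-- Points `p` of the imaginary axis and `q` of the semicircle over `[x, y]`, at distance at most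
that of the two geodesics, are the feet of the common perpendicular. -/
theorem eq_feet_of_dist_le {x y : ℝ} (hxy : x < y) {p q : ℍ}
    (hp : p.re = 0) (hq : q ∈ Semicircle x y)
    (hle : ((p.re - q.re) ^ 2 + p.im ^ 2 + q.im ^ 2) / (2 * p.im * q.im) ≤ (x + y) / (y - x)) :
    p.im ^ 2 = x * y ∧ (x + y) * q.re = 2 * (x * y) ∧ q.re ^ 2 + q.im ^ 2 = x * y := by
  have hpi := p.im_pos
  have hqi := q.im_pos
  have hyx : 0 < y - x := sub_pos.mpr hxy
  rw [mem_semicircle_iff] at hq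
  rw [div_le_div_iff₀ (by positivity) hyx, hp] at hle
  generalize p.im = t at *
  generalize q.im = Y at *
  generalize q.re = X at *
  obtain ⟨n, hn⟩ : ∃ n, n = X ^ 2 + Y ^ 2 := ⟨_, rfl⟩
  have hX : (x + y) * X = n + x * y := by rw [hn]; linarith
  have hle' : (y - x) * (t ^ 2 + n) ≤ 2 * t * Y * (x + y) := by rw [hn]; linarith
  have hn0 : 0 < n := by rw [hn]; positivity
  have hsq : ((y - x) * (t ^ 2 + n)) ^ 2 ≤ (2 * t * Y * (x + y)) ^ 2 :=
    pow_le_pow_left₀ (by positivity) hle' 2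
  have hYs : (Y * (x + y)) ^ 2 = (x + y) ^ 2 * n - (n + x * y) ^ 2 := by
    rw [← hX, hn]; ring
  have hsum : (y - x) ^ 2 * (t ^ 2 - n) ^ 2 + 4 * t ^ 2 * (n - x * y) ^ 2 ≤ 0 := by
    have h : (2 * t * Y * (x + y)) ^ 2 = 4 * t ^ 2 * ((x + y) ^ 2 * n - (n + x * y) ^ 2) := by
      rw [← hYs]; ring
    rw [h] at hsq
    linarith
  have hA : 0 ≤ (y - x) ^ 2 * (t ^ 2 - n) ^ 2 := by positivity
  have hB : 0 ≤ 4 * t ^ 2 * (n - x * y) ^ 2 := by positivity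
  have hA0 : (y - x) ^ 2 * (t ^ 2 - n) ^ 2 = 0 := by linarith
  have hB0 : 4 * t ^ 2 * (n - x * y) ^ 2 = 0 := by linarith
  have hnx : n = x * y := by
    have := (mul_eq_zero.mp hB0).resolve_left (by positivity)
    exact sub_eq_zero.mp (pow_eq_zero_iff two_ne_zero |>.mp this)
  have htn : t ^ 2 = n := by
    have := (mul_eq_zero.mp hA0).resolve_left (by positivity)
    exact sub_eq_zero.mp (pow_eq_zero_iff two_ne_zero |>.mp this)
  exact ⟨htn.trans hnx, by rw [hX, hnx]; ring, by rw [← hn, hnx]⟩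

/-- The feet of the common perpendicular of the imaginary axis and a semicircle are fixed by every
isometry that preserves both geodesics. -/
theorem exists_fixed_feet {x y : ℝ} (hx : 0 < x) (hxy : x < y) {f : ℍ → ℍ} (hf : Isometry f)
    (hV : ∀ z, z.re = 0 → (f z).re = 0)
    (hS : ∀ z ∈ Semicircle x y, f z ∈ Semicircle x y) :
    ∃ p q : ℍ, f p = p ∧ f q = q ∧ p.re = 0 ∧ p.im ^ 2 = x * y ∧ q.re ≠ 0 ∧
      q.re ^ 2 + q.im ^ 2 = x * y := by
  have hy := hx.trans hxy
  have hyx : 0 < y - x := sub_pos.mpr hxy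
  obtain ⟨ρ, hρ0, hρ⟩ : ∃ ρ : ℝ, 0 < ρ ∧ ρ ^ 2 = x * y :=
    ⟨√(x * y), by positivity, Real.sq_sqrt (by positivity)⟩
  let p : ℍ := ⟨⟨0, ρ⟩, hρ0⟩
  let q : ℍ := ⟨⟨2 * ρ ^ 2 / (x + y), ρ * (y - x) / (x + y)⟩, by positivity⟩
  have hpre : p.re = 0 := rfl
  have hpim : p.im = ρ := rfl
  have hqre : q.re = 2 * ρ ^ 2 / (x + y) := rfl
  have hqim : q.im = ρ * (y - x) / (x + y) := rfl
  have hqn : q.re ^ 2 + q.im ^ 2 = x * y := by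
    rw [hqre, hqim]
    field_simp
    linear_combination (4 * ρ ^ 2 + 4 * x * y + (y - x) ^ 2) * hρ
  have hqX : (x + y) * q.re = 2 * (x * y) := by
    rw [hqre, ← hρ]
    field_simp
  have hqS : q ∈ Semicircle x y := by
    rw [mem_semicircle_iff]
    linarith
  have hd : ((p.re - q.re) ^ 2 + p.im ^ 2 + q.im ^ 2) / (2 * p.im * q.im) =
      (x + y) / (y - x) := by
    have h : (p.re - q.re) ^ 2 + p.im ^ 2 + q.im ^ 2 = 2 * ρ ^ 2 := by
      rw [hpre, hpim]
      linarith
    rw [h, hpim, hqim]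
    field_simp
  obtain ⟨h1, h2, h3⟩ := eq_feet_of_dist_le hxy (hV p hpre) (hS q hqS)
    ((cosh_dist_eq_of_isometry hf p q).trans hd).le
  have hre : (f q).re = q.re := mul_left_cancel₀ (by positivity) (h2.trans hqX.symm)
  refine ⟨p, q, ext_re_im ((hV p hpre).trans hpre.symm) ?_, ext_re_im hre ?_, hpre, hρ, ?_, hqn⟩
  · exact (pow_left_inj₀ (f p).im_pos.le p.im_pos.le two_ne_zero).mp (h1.trans hρ.symm)
  · refine (pow_left_inj₀ (f q).im_pos.le q.im_pos.le two_ne_zero).mp ?_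
    rw [hre] at h3
    linarith
  · rw [hqre]
    positivity

/-- An isometry preserving the imaginary axis and the semicircle over `[x, y]` sends every point
to itself or to its image under the inversion in the circle `|z| ^ 2 = x * y`. -/
theorem eq_or_inversion {x y : ℝ} (hx : 0 < x) (hxy : x < y) {f : ℍ → ℍ} (hf : Isometry f)
    (hV : ∀ z, z.re = 0 → (f z).re = 0)
    (hS : ∀ z ∈ Semicircle x y, f z ∈ Semicircle x y) (z : ℍ) :
    f z = z ∨ ((f z).re = x * y * z.re / (z.re ^ 2 + z.im ^ 2) ∧
      (f z).im = x * y * z.im / (z.re ^ 2 + z.im ^ 2)) := by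
  obtain ⟨p, q, hfp, hfq, hpre, hpim, hqre, hqn⟩ := exists_fixed_feet hx hxy hf hV hS
  have hp := cosh_dist_eq_of_isometry hf z p
  have hq := cosh_dist_eq_of_isometry hf z q
  have hzi := z.im_pos
  have hfi := (f z).im_pos
  have hpi := p.im_pos
  have hqi := q.im_pos
  rw [hfp, hpre, div_eq_div_iff (by positivity) (by positivity)] at hp
  rw [hfq, div_eq_div_iff (by positivity) (by positivity)] at hq
  have hp' : ((f z).re ^ 2 + (f z).im ^ 2 + x * y) * z.im =
      (z.re ^ 2 + z.im ^ 2 + x * y) * (f z).im := by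
    rw [← hpim]
    apply mul_left_cancel₀ (by positivity : 2 * p.im ≠ 0)
    linear_combination hp
  have hq' : ((f z).re ^ 2 + (f z).im ^ 2 + x * y - 2 * (f z).re * q.re) * z.im =
      (z.re ^ 2 + z.im ^ 2 + x * y - 2 * z.re * q.re) * (f z).im := by
    rw [← hqn]
    apply mul_left_cancel₀ (by positivity : 2 * q.im ≠ 0)
    linear_combination hq
  have hre : (f z).re * z.im = z.re * (f z).im := by
    apply mul_left_cancel₀ (mul_ne_zero two_ne_zero hqre)
    linear_combination hp' - hq'
  obtain ⟨l, hl⟩ : ∃ l, l = (f z).im / z.im := ⟨_, rfl⟩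
  have him : (f z).im = l * z.im := by rw [hl]; field_simp
  have hre' : (f z).re = l * z.re := by
    apply mul_right_cancel₀ hzi.ne'
    rw [hre, him]
    ring
  have hD : 0 < z.re ^ 2 + z.im ^ 2 := by positivity
  have hl' : z.im * ((l - 1) * (l * (z.re ^ 2 + z.im ^ 2) - x * y)) = 0 := by
    rw [him, hre'] at hp'
    linear_combination hp'
  rcases mul_eq_zero.mp ((mul_eq_zero.mp hl').resolve_left hzi.ne') with h | h
  · left
    rw [sub_eq_zero.mp h, one_mul] at him hre'
    exact ext_re_im hre' him
  · right
    have : l = x * y / (z.re ^ 2 + z.im ^ 2) := by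
      rw [eq_div_iff hD.ne']
      linarith
    rw [him, hre', this]
    constructor <;> ring

/-- A nontrivial isometry preserving the imaginary axis and the semicircle over `[x, y]` is the
inversion in the circle `|z| ^ 2 = x * y`. -/
theorem inversion_of_ne_id {x y : ℝ} (hx : 0 < x) (hxy : x < y) {f : ℍ → ℍ} (hf : Isometry f)
    (hne : ∃ z, f z ≠ z) (hV : ∀ z, z.re = 0 → (f z).re = 0)
    (hS : ∀ z ∈ Semicircle x y, f z ∈ Semicircle x y) (z : ℍ) :
    (f z).re = x * y * z.re / (z.re ^ 2 + z.im ^ 2) ∧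
      (f z).im = x * y * z.im / (z.re ^ 2 + z.im ^ 2) := by
  obtain ⟨w, hw⟩ := hne
  have hw' := (eq_or_inversion hx hxy hf hV hS w).resolve_left hw
  rcases eq_or_inversion hx hxy hf hV hS z with hz | hz
  · have h := cosh_dist_eq_of_isometry hf w z
    have hwi := w.im_pos
    have hzi := z.im_pos
    have hy := hx.trans hxy
    have hD : 0 < w.re ^ 2 + w.im ^ 2 := by positivity
    have hD' : 0 < z.re ^ 2 + z.im ^ 2 := by positivity
    have hwne : w.re ^ 2 + w.im ^ 2 ≠ x * y := by
      intro h0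
      apply hw
      apply ext_re_im
      · rw [hw'.1, h0]; field_simp
      · rw [hw'.2, h0]; field_simp
    have key : (w.re ^ 2 + w.im ^ 2 - x * y) * (z.re ^ 2 + z.im ^ 2 - x * y) = 0 := by
      rw [hz, hw'.1, hw'.2] at h
      field_simp at h
      have hk : (w.re ^ 2 + w.im ^ 2) * ((w.re ^ 2 + w.im ^ 2 - x * y) *
          (z.re ^ 2 + z.im ^ 2 - x * y)) = 0 := by
        linear_combination h
      exact (mul_eq_zero.mp hk).resolve_left hD.ne'
    have hzz : z.re ^ 2 + z.im ^ 2 = x * y :=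
      sub_eq_zero.mp ((mul_eq_zero.mp key).resolve_left (sub_ne_zero.mpr hwne))
    rw [hz, hzz]
    constructor <;> field_simp
  · exact hz

/-- The Möbius map `z ↦ -v - 1 / (z - e)` of the upper half-plane. -/
noncomputable def sendToInfty (e v : ℝ) (z : ℍ) : ℍ :=
  ⟨⟨-v - (z.re - e) / ((z.re - e) ^ 2 + z.im ^ 2), z.im / ((z.re - e) ^ 2 + z.im ^ 2)⟩, by
    have := z.im_pos
    positivity⟩

theorem sendToInfty_re (e v : ℝ) (z : ℍ) :
    (sendToInfty e v z).re = -v - (z.re - e) / ((z.re - e) ^ 2 + z.im ^ 2) := rfl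

theorem sendToInfty_im (e v : ℝ) (z : ℍ) :
    (sendToInfty e v z).im = z.im / ((z.re - e) ^ 2 + z.im ^ 2) := rfl

theorem sendToInfty_sendToInfty (e v : ℝ) (z : ℍ) :
    sendToInfty (-v) (-e) (sendToInfty e v z) = z := by
  have hz := z.im_pos
  have hD : 0 < (z.re - e) ^ 2 + z.im ^ 2 := by positivity
  have hE : (-v - (z.re - e) / ((z.re - e) ^ 2 + z.im ^ 2) - -v) ^ 2 +
      (z.im / ((z.re - e) ^ 2 + z.im ^ 2)) ^ 2 = 1 / ((z.re - e) ^ 2 + z.im ^ 2) := by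
    field_simp
    ring
  apply ext_re_im
  · rw [sendToInfty_re, sendToInfty_re, sendToInfty_im, hE]
    field_simp
    ring
  · rw [sendToInfty_im, sendToInfty_re, sendToInfty_im, hE]
    field_simp

/-- `sendToInfty e v` as a permutation. -/
noncomputable def sendToInftyEquiv (e v : ℝ) : Equiv.Perm ℍ where
  toFun := sendToInfty e v
  invFun := sendToInfty (-v) (-e)
  left_inv := sendToInfty_sendToInfty e v
  right_inv z := by simpa using sendToInfty_sendToInfty (-v) (-e) z

theorem isometry_sendToInftyEquiv (e v : ℝ) : Isometry (sendToInftyEquiv e v) := by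
  refine Isometry.of_dist_eq fun z w => ?_
  have hz := z.im_pos
  have hw := w.im_pos
  have hD : 0 < (z.re - e) ^ 2 + z.im ^ 2 := by positivity
  have hE : 0 < (w.re - e) ^ 2 + w.im ^ 2 := by positivity
  have h : Real.cosh (dist (sendToInfty e v z) (sendToInfty e v w)) = Real.cosh (dist z w) := by
    rw [cosh_dist', cosh_dist']
    simp only [sendToInfty_re, sendToInfty_im]
    field_simp
    ring
  exact Real.cosh_strictMonoOn.injOn dist_nonneg dist_nonneg h

theorem sendToInfty_re_eq_zero_iff {e e' : ℝ} (he : e ≠ e') (z : ℍ) :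
    (sendToInfty e (-1 / (e' - e)) z).re = 0 ↔ z ∈ Semicircle e e' := by
  have hz := z.im_pos
  have hD : 0 < (z.re - e) ^ 2 + z.im ^ 2 := by positivity
  have hn : e' - e ≠ 0 := sub_ne_zero.mpr he.symm
  rw [sendToInfty_re, mem_semicircle_iff]
  field_simp
  constructor <;> intro h <;> linarith

theorem sendToInfty_mem_semicircle_iff {e v c d : ℝ} (hc : c ≠ e) (hd : d ≠ e) (z : ℍ) :
    sendToInfty e v z ∈ Semicircle (-v - 1 / (c - e)) (-v - 1 / (d - e)) ↔
      z ∈ Semicircle c d := by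
  have hz := z.im_pos
  have hD : 0 < (z.re - e) ^ 2 + z.im ^ 2 := by positivity
  have hc' : c - e ≠ 0 := sub_ne_zero.mpr hc
  have hd' : d - e ≠ 0 := sub_ne_zero.mpr hd
  have key : ((sendToInfty e v z).re - (-v - 1 / (c - e))) *
      ((sendToInfty e v z).re - (-v - 1 / (d - e))) + (sendToInfty e v z).im ^ 2 =
      ((z.re - c) * (z.re - d) + z.im ^ 2) /
        ((c - e) * (d - e) * ((z.re - e) ^ 2 + z.im ^ 2)) := by
    rw [sendToInfty_re, sendToInfty_im]
    field_simp
    ring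
  rw [mem_semicircle_iff, mem_semicircle_iff, key, div_eq_zero_iff]
  simp [hc', hd', hD.ne']

/-- Conjugating by `sendToInfty` turns a nontrivial isometry preserving two geodesics into an
inversion. -/
theorem sendToInfty_reflection {e e' v c d : ℝ} (he : e ≠ e') (hv : v = -1 / (e' - e))
    (hc : c ≠ e) (hd : d ≠ e) (hx : 0 < -v - 1 / (c - e))
    (hxy : -v - 1 / (c - e) < -v - 1 / (d - e))
    {f : Equiv.Perm ℍ} (hf : Isometry f) (hne : f ≠ Equiv.refl ℍ)
    (hV : f '' Semicircle e e' = Semicircle e e') (hS : f '' Semicircle c d = Semicircle c d)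
    (z : ℍ) :
    let w := sendToInfty e v z
    let k := (-v - 1 / (c - e)) * (-v - 1 / (d - e)) / (w.re ^ 2 + w.im ^ 2)
    (sendToInfty e v (f z)).re = k * w.re ∧ (sendToInfty e v (f z)).im = k * w.im := by
  intro w k
  set g := sendToInftyEquiv e v
  have hg : ∀ z, g z = sendToInfty e v z := fun _ => rfl
  have hgi := isometry_sendToInftyEquiv e v
  have hF : Isometry (fun z => g (f (g.symm z))) :=
    hgi.comp (hf.comp (hgi.right_inv g.apply_symm_apply))
  obtain ⟨z₀, hz₀⟩ : ∃ z, f z ≠ z := by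
    by_contra! h
    exact hne (Equiv.ext h)
  have h := inversion_of_ne_id hx hxy hF ⟨g z₀, by simpa using hz₀⟩
    (fun z hz => by
      rw [← g.apply_symm_apply z, hg, hv, sendToInfty_re_eq_zero_iff he] at hz
      rw [hg, hv, sendToInfty_re_eq_zero_iff he, ← hV]
      exact mem_image_of_mem _ hz)
    (fun z hz => by
      rw [← g.apply_symm_apply z, hg, sendToInfty_mem_semicircle_iff hc hd] at hz
      rw [hg, sendToInfty_mem_semicircle_iff hc hd, ← hS]
      exact mem_image_of_mem _ hz) (g z)
  simp only [g.symm_apply_apply] at h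
  simp only [hg] at h
  refine ⟨h.1.trans ?_, h.2.trans ?_⟩ <;> simp only [k, w] <;> ring

/-- The real points in the closure of a set of points mapped by `sendToInfty e v` into the
semicircle over `[ξ, η]` are mapped to `ξ` or `η`. -/
theorem ofReal_mem_closure_of_sendToInfty {e v ξ η u : ℝ} {S : Set ℍ}
    (hS : ∀ z ∈ S, sendToInfty e v z ∈ Semicircle ξ η)
    (hu : (u : ℂ) ∈ closure ((fun z : ℍ => (z : ℂ)) '' S)) :
    (v + ξ) * (u - e) = -1 ∨ (v + η) * (u - e) = -1 := by
  have hcl : IsClosed {w : ℂ | (v + ξ) * (v + η) * ((w.re - e) ^ 2 + w.im ^ 2) +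
      (2 * v + ξ + η) * (w.re - e) + 1 = 0} := isClosed_eq (by fun_prop) (by fun_prop)
  have hsub : (fun z : ℍ => (z : ℂ)) '' S ⊆ {w : ℂ | (v + ξ) * (v + η) *
      ((w.re - e) ^ 2 + w.im ^ 2) + (2 * v + ξ + η) * (w.re - e) + 1 = 0} := by
    rintro _ ⟨z, hzS, rfl⟩
    have hz := z.im_pos
    have hD : 0 < (z.re - e) ^ 2 + z.im ^ 2 := by positivity
    have h := mem_semicircle_iff.mp (hS z hzS)
    rw [sendToInfty_re, sendToInfty_im] at h
    field_simp at h
    have h' : ((z.re - e) ^ 2 + z.im ^ 2) * ((v + ξ) * (v + η) *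
        ((z.re - e) ^ 2 + z.im ^ 2) + (2 * v + ξ + η) * (z.re - e) + 1) = 0 := by
      linear_combination h
    exact (mul_eq_zero.mp h').resolve_left hD.ne'
  have h := closure_minimal hsub hcl hu
  simp only [mem_ofPred_eq, Complex.ofReal_re, Complex.ofReal_im] at h
  have h' : ((v + ξ) * (u - e) + 1) * ((v + η) * (u - e) + 1) = 0 := by
    linear_combination h
  rcases mul_eq_zero.mp h' with h | h
  · left; linarith
  · right; linarith

/-- Let `P`, `Q` be the reflections preserving the geodesic over `e, e'` and the geodesics over
`c, d` and `p, q` respectively. In the coordinate `t ↦ 1 / (e' - e) - 1 / (t - e)`, the endpoints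
of the image of the geodesic over `p, q` under a positive power of `P * Q` lie between `0` and the
coordinate of `c`. -/
theorem endpoints_between {e e' c d p q : ℝ} (he : e ≠ e') (hc : c ≠ e) (hd : d ≠ e)
    (hp : p ≠ e) (hq : q ≠ e) (h1 : 1 / (c - e) < 1 / (e' - e))
    (h2 : 1 / (d - e) < 1 / (c - e)) (h3 : 1 / (p - e) < 1 / (d - e))
    (h4 : 1 / (q - e) < 1 / (p - e)) {P Q : Equiv.Perm ℍ} (hP : Isometry P) (hQ : Isometry Q)
    (hPne : P ≠ Equiv.refl ℍ) (hQne : Q ≠ Equiv.refl ℍ)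
    (hPV : P '' Semicircle e e' = Semicircle e e')
    (hQV : Q '' Semicircle e e' = Semicircle e e')
    (hPS : P '' Semicircle c d = Semicircle c d) (hQS : Q '' Semicircle p q = Semicircle p q)
    {m : ℕ} (hm : 0 < m) {u : ℝ}
    (hu : (u : ℂ) ∈ closure ((fun z : ℍ => (z : ℂ)) '' (⇑((P * Q) ^ m) '' Semicircle p q))) :
    1 / (c - e) < 1 / (u - e) ∧ 1 / (u - e) < 1 / (e' - e) := by
  obtain ⟨v, hv⟩ : ∃ v, v = -1 / (e' - e) := ⟨_, rfl⟩
  have hv' : 1 / (e' - e) = -v := by rw [hv]; ring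
  rw [hv'] at h1 ⊢
  obtain ⟨a, ha⟩ : ∃ a, a = -v - 1 / (c - e) := ⟨_, rfl⟩
  obtain ⟨b, hb⟩ : ∃ b, b = -v - 1 / (d - e) := ⟨_, rfl⟩
  obtain ⟨r, hr⟩ : ∃ r, r = -v - 1 / (p - e) := ⟨_, rfl⟩
  obtain ⟨s, hs⟩ : ∃ s, s = -v - 1 / (q - e) := ⟨_, rfl⟩
  have ha0 : 0 < a := by linarith
  have hab : a < b := by linarith
  have hbr : b < r := by linarith
  have hrs : r < s := by linarith
  have hb0 := ha0.trans hab
  have hr0 := hb0.trans hbr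
  have hs0 := hr0.trans hrs
  set k := a * b / (r * s) with hk
  have hk0 : 0 < k := by positivity
  have hPr := sendToInfty_reflection he hv hc hd (by linarith) (by linarith) hP hPne hPV hPS
  have hQr := sendToInfty_reflection he hv hp hq (by linarith) (by linarith) hQ hQne hQV hQS
  rw [← ha, ← hb] at hPr
  rw [← hr, ← hs] at hQr
  have hPQ : ∀ z, (sendToInfty e v ((P * Q) z)).re = k * (sendToInfty e v z).re ∧
      (sendToInfty e v ((P * Q) z)).im = k * (sendToInfty e v z).im := by
    intro z
    have hz := (sendToInfty e v z).im_pos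
    have hD : 0 < (sendToInfty e v z).re ^ 2 + (sendToInfty e v z).im ^ 2 := by positivity
    obtain ⟨hP1, hP2⟩ := hPr (Q z)
    obtain ⟨hQ1, hQ2⟩ := hQr z
    rw [hQ1, hQ2] at hP1 hP2
    rw [Equiv.Perm.mul_apply, hP1, hP2]
    generalize (sendToInfty e v z).re = x at *
    generalize (sendToInfty e v z).im = y at *
    have hE : (r * s / (x ^ 2 + y ^ 2) * x) ^ 2 + (r * s / (x ^ 2 + y ^ 2) * y) ^ 2 =
        (r * s) ^ 2 / (x ^ 2 + y ^ 2) := by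
      field_simp
    rw [hE]
    constructor <;> (rw [hk]; field_simp)
  have hpow : ∀ n : ℕ, ∀ z, (sendToInfty e v (((P * Q) ^ n) z)).re =
      k ^ n * (sendToInfty e v z).re ∧
      (sendToInfty e v (((P * Q) ^ n) z)).im = k ^ n * (sendToInfty e v z).im := by
    intro n
    induction n with
    | zero => simp
    | succ n ih =>
      intro z
      rw [pow_succ, Equiv.Perm.mul_apply, (ih _).1, (ih _).2, (hPQ z).1, (hPQ z).2]
      constructor <;> ring
  have hks : k * s < a := by
    rw [hk, show a * b / (r * s) * s = a * (b / r) by field_simp]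
    exact mul_lt_of_lt_one_right ha0 ((div_lt_one hr0).mpr hbr)
  have hk1 : k < 1 := by nlinarith
  have hkm : k ^ m ≤ k := pow_le_of_le_one hk0.le hk1.le hm.ne'
  have hkm0 : 0 < k ^ m := by positivity
  have hmem : ∀ z ∈ ⇑((P * Q) ^ m) '' Semicircle p q,
      sendToInfty e v z ∈ Semicircle (k ^ m * r) (k ^ m * s) := by
    rintro _ ⟨z, hz, rfl⟩
    rw [← sendToInfty_mem_semicircle_iff (v := v) hp hq, ← hr, ← hs, mem_semicircle_iff] at hz
    rw [mem_semicircle_iff, (hpow m z).1, (hpow m z).2]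
    linear_combination (k ^ m) ^ 2 * hz
  have hfin : ∀ ξ, 0 < ξ → ξ < a → (v + ξ) * (u - e) = -1 →
      1 / (c - e) < 1 / (u - e) ∧ 1 / (u - e) < -v := by
    intro ξ hξ hξa h
    have hne : u - e ≠ 0 := by
      intro h0
      rw [h0] at h
      norm_num at h
    have : 1 / (u - e) = -(v + ξ) := by
      rw [div_eq_iff hne]
      linarith
    rw [this]
    constructor <;> linarith
  rcases ofReal_mem_closure_of_sendToInfty hmem hu with h | h
  · exact hfin _ (by positivity) (by nlinarith) h
  · exact hfin _ (by positivity) (by nlinarith) h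

end PairOfPants

open PairOfPants


theorem endpoints_of_translated_lift_lie_in_opposite_arc
    (A a₂ b₂ a₃ b₃ B : ℝ)
    (h1 : A < a₂) (h2 : a₂ < b₂) (h3 : b₂ < a₃) (h4 : a₃ < b₃) (h5 : b₃ < B)
    -- the three boundary lifts and their opposite arcs at infinity :
    (Lt : Fin 3 → Set ℍ)
    (hLt : Lt = ![Semicircle A B, Semicircle a₂ b₂, Semicircle a₃ b₃])
    (Iarc : Fin 3 → Set ℝ)
    (hIarc : Iarc = ![Set.Icc b₂ a₃, Set.Icc b₃ B, Set.Icc A a₂])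
    -- the seam reflections :
    (R : Fin 3 → Equiv.Perm ℍ)
    (hRiso : ∀ i, Isometry ⇑(R i))
    (hRinv : ∀ i, ∀ z, R i (R i z) = z)
    (hRne : ∀ i, R i ≠ Equiv.refl ℍ)
    (hRfix : ∀ i, (⇑(R i)) '' Lt (i + 1) = Lt (i + 1) ∧ (⇑(R i)) '' Lt (i + 2) = Lt (i + 2)) :
    -- for m > 0, both endpoints at infinity of γ_{i+1}^m(L̃ᵢ) lie in Iᵢ,
    -- where γ_{i+1} = R i ∘ R (i+2) :
    ∀ i : Fin 3, ∀ m : ℕ, 0 < m → ∀ u : ℝ,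
      (u : ℂ) ∈ closure ((fun z : ℍ => (z : ℂ)) ''
        ((⇑((R i * R (i + 2)) ^ m)) '' Lt i)) →
      u ∈ Iarc i := by
  subst hLt hIarc
  have key : ∀ (i : Fin 3) {e e' c d p q : ℝ} {L : Fin 3 → Set ℍ},
      (∀ i, R i '' L (i + 1) = L (i + 1) ∧ R i '' L (i + 2) = L (i + 2)) →
      L (i + 1) = Semicircle e e' → L (i + 2) = Semicircle c d → L i = Semicircle p q →
      e ≠ e' → c ≠ e → d ≠ e → p ≠ e → q ≠ e → 1 / (c - e) < 1 / (e' - e) →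
      1 / (d - e) < 1 / (c - e) → 1 / (p - e) < 1 / (d - e) → 1 / (q - e) < 1 / (p - e) →
      ∀ m : ℕ, 0 < m → ∀ u : ℝ,
      (u : ℂ) ∈ closure ((fun z : ℍ => (z : ℂ)) '' (⇑((R i * R (i + 2)) ^ m) '' L i)) →
      1 / (c - e) < 1 / (u - e) ∧ 1 / (u - e) < 1 / (e' - e) := by
    intro i e e' c d p q L hL hL1 hL2 hL0 he hc hd hp hq h1 h2 h3 h4 m hm u hu
    have hi1 : i + 2 + 1 = i := by fin_cases i <;> rfl
    have hi2 : i + 2 + 2 = i + 1 := by fin_cases i <;> rfl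
    have hP := hL i
    have hQ := hL (i + 2)
    rw [hi1, hi2, hL0, hL1] at hQ
    rw [hL1, hL2] at hP
    rw [hL0] at hu
    exact endpoints_between he hc hd hp hq h1 h2 h3 h4 (hRiso i) (hRiso (i + 2)) (hRne i)
      (hRne (i + 2)) hP.1 hQ.2 hP.2 hQ.1 hm hu
  have hpos : ∀ s t : ℝ, 0 < s → s < t → 1 / t < 1 / s := fun s t => one_div_lt_one_div_of_lt
  have hneg : ∀ s t : ℝ, t < 0 → s < t → 1 / t < 1 / s := fun s t =>
    one_div_lt_one_div_of_neg_of_lt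
  have hsgn : ∀ s t : ℝ, s < 0 → 0 < t → 1 / s < 1 / t := fun s t hs ht =>
    (one_div_neg.mpr hs).trans (one_div_pos.mpr ht)
  intro i m hm u hu
  fin_cases i
  · obtain ⟨hl, hr⟩ := key 0 (e := a₂) (e' := b₂) (c := a₃) (d := b₃) (p := B) (q := A) hRfix rfl
      rfl (semicircle_comm A B) (by linarith) (by linarith) (by linarith) (by linarith)
      (by linarith) (hpos _ _ (by linarith) (by linarith)) (hpos _ _ (by linarith) (by linarith))
      (hpos _ _ (by linarith) (by linarith)) (hsgn _ _ (by linarith) (by linarith)) m hm u hu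
    have hua := one_div_pos.mp ((one_div_pos.mpr (by linarith)).trans hl)
    have hl' := lt_of_one_div_lt_one_div (by linarith) hl
    have hr' := lt_of_one_div_lt_one_div hua hr
    exact ⟨by linarith, by linarith⟩
  · obtain ⟨hl, hr⟩ := key 1 (e := a₃) (e' := b₃) (c := B) (d := A) (p := a₂) (q := b₂) hRfix rfl
      (semicircle_comm A B) rfl (by linarith) (by linarith) (by linarith) (by linarith)
      (by linarith) (hpos _ _ (by linarith) (by linarith)) (hsgn _ _ (by linarith) (by linarith))
      (hneg _ _ (by linarith) (by linarith)) (hneg _ _ (by linarith) (by linarith)) m hm u hu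
    have hua := one_div_pos.mp ((one_div_pos.mpr (by linarith)).trans hl)
    have hl' := lt_of_one_div_lt_one_div (by linarith) hl
    have hr' := lt_of_one_div_lt_one_div hua hr
    exact ⟨by linarith, by linarith⟩
  · obtain ⟨hl, hr⟩ := key 2 (e := B) (e' := A) (c := a₂) (d := b₂) (p := a₃) (q := b₃) hRfix
      (semicircle_comm A B) rfl rfl (by linarith) (by linarith) (by linarith) (by linarith)
      (by linarith) (hneg _ _ (by linarith) (by linarith)) (hneg _ _ (by linarith) (by linarith))
      (hneg _ _ (by linarith) (by linarith)) (hneg _ _ (by linarith) (by linarith)) m hm u hu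
    have huB := one_div_neg.mp (hr.trans (one_div_neg.mpr (by linarith)))
    have hl' := lt_of_neg_of_one_div_lt_one_div huB hl
    have hr' := lt_of_neg_of_one_div_lt_one_div (by linarith) hr
    exact ⟨by linarith, by linarith⟩
end
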